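/- Let U ⊆ B(H) be a hyperreflexive weak* closed masa-bimodule and Φ ∈ 𝔉H. Then the algebraic sum U + ran Φ is hyperreflexive, and d(T, U + ran Φ) ≤ k(U)·λ(Φ)·α(T, U + ran Φ) for all T ∈ B(H). -/

import Mathlib

open scoped InnerProductSpace Pointwise

noncomputable section

namespace SchurHyper

/-- `B H` is the algebra of bounded linear operators on `H`. -/
abbrev B (H : Type*) [NormedAddCommGroup H] [InnerProductSpace ℂ H] : Type _ := H →L[ℂ] H

variable (H : Type*) [NormedAddCommGroup H] [InnerProductSpace ℂ H]

/-- A linear functional on `B H` is *normal* (weak* continuous) if it arises from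
the duality with the trace class, i.e. it is of the form
`T ↦ ∑ₙ ⟪yₙ, T xₙ⟫` for square-summable sequences `(xₙ)`, `(yₙ)`
(recall that the inner product is conjugate-linear in its first slot). -/
def IsNormalFunctional (ω : B H →ₗ[ℂ] ℂ) : Prop :=
  ∃ x y : ℕ → H, Summable (fun n => ‖x n‖ ^ 2) ∧ Summable (fun n => ‖y n‖ ^ 2) ∧
    ∀ T : B H, ω T = ∑' n, ⟪y n, T (x n)⟫_ℂ

/-- The weak* topology on `B H`: the topology induced by the normal functionals. -/
def weakStarTopology : TopologicalSpace (B H) :=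
  TopologicalSpace.induced
    (fun (T : B H) (ω : {ω : B H →ₗ[ℂ] ℂ // IsNormalFunctional H ω}) => ω.1 T)
    inferInstance

/-- A set of operators is weak* closed if it is closed in the weak* topology. -/
def WStarClosed (X : Set (B H)) : Prop := @IsClosed _ (weakStarTopology H) X

/-- The weak* closure of a set of operators. -/
def wStarClosure (X : Set (B H)) : Set (B H) := @closure _ (weakStarTopology H) X

/-- A map on `B H` is weak* continuous if it is continuous with respect to the
weak* topology on both sides. -/
def WStarContinuous (Φ : B H →L[ℂ] B H) : Prop :=
  @Continuous _ _ (weakStarTopology H) (weakStarTopology H) Φ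

variable {H}
variable [CompleteSpace H]

/-- A maximal abelian selfadjoint subalgebra of `B H`: an abelian selfadjoint
subalgebra which contains every operator commuting with it (equivalently, it
coincides with its own commutant). -/
def IsMasa (D : StarSubalgebra ℂ (B H)) : Prop :=
  (∀ A ∈ D, ∀ C ∈ D, A * C = C * A) ∧
  (∀ T : B H, (∀ A ∈ D, T * A = A * T) → T ∈ D)

/-- A Schur multiplier: a weak* continuous `D`-bimodule map on `B H`. -/
def IsSchurMultiplier (D : StarSubalgebra ℂ (B H)) (Φ : B H →L[ℂ] B H) : Prop :=
  WStarContinuous H Φ ∧ ∀ A ∈ D, ∀ C ∈ D, ∀ T : B H, Φ (A * T * C) = A * Φ T * C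

/-- A Schur idempotent: an idempotent Schur multiplier. -/
def IsSchurIdempotent (D : StarSubalgebra ℂ (B H)) (Φ : B H →L[ℂ] B H) : Prop :=
  IsSchurMultiplier D Φ ∧ Φ.comp Φ = Φ

/-- A subspace `X ⊆ B H` is a `D`-bimodule if `D X D ⊆ X`. -/
def IsBimodule (D : StarSubalgebra ℂ (B H)) (X : Submodule ℂ (B H)) : Prop :=
  ∀ A ∈ D, ∀ C ∈ D, ∀ T ∈ X, A * T * C ∈ X

/-- The Arveson distance `α(T, X)`. -/
def arveson (T : B H) (X : Set (B H)) : ℝ :=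
  ⨆ ξ : {ξ : H // ‖ξ‖ = 1}, ⨅ S : X, ‖T ξ.1 - S.1 ξ.1‖

/-- The set of hyperreflexivity constants of `X`. -/
def hyperSet (X : Set (B H)) : Set ℝ :=
  {k | 0 < k ∧ ∀ T : B H, Metric.infDist T X ≤ k * arveson T X}

/-- A subspace is hyperreflexive if `d(T, X) ≤ k ⬝ α(T, X)` for some `k > 0`. -/
def Hyperreflexive (X : Set (B H)) : Prop := (hyperSet X).Nonempty

/-- The hyperreflexivity constant `k(X)`: the least constant that works. -/
def hyperConst (X : Set (B H)) : ℝ := sInf (hyperSet X)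

/-- The set of constants `λ` witnessing that a Schur idempotent lies in `𝔉H`. -/
def lamSet (Φ : B H →L[ℂ] B H) : Set ℝ :=
  {l | 0 < l ∧ ∀ T : B H, ‖T - Φ T‖ ≤ l * arveson T (Set.range Φ)}

/-- The class `𝔉H` of Schur idempotents `Φ` such that
`‖T - Φ T‖ ≤ λ ⬝ α(T, ran Φ)` for some `λ > 0` and all `T`. -/
def MemFH (D : StarSubalgebra ℂ (B H)) (Φ : B H →L[ℂ] B H) : Prop :=
  IsSchurIdempotent D Φ ∧ (lamSet Φ).Nonempty

/-- The constant `λ(Φ)`: the least constant witnessing membership of `𝔉H`. -/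
def lam (Φ : B H →L[ℂ] B H) : ℝ := sInf (lamSet Φ)

/-- A ternary masa-bimodule condition: `S T* R ∈ M` whenever `S, T, R ∈ M`. -/
def IsTernary (M : Submodule ℂ (B H)) : Prop :=
  ∀ S ∈ M, ∀ T ∈ M, ∀ R ∈ M, S * star T * R ∈ M

end SchurHyper

open SchurHyper

namespace SchurHyper

section Arveson

variable {H : Type*} [NormedAddCommGroup H] [InnerProductSpace ℂ H]

lemma iInf_norm_sub_le (T : B H) {X : Set (B H)} {S : B H} (hS : S ∈ X) (ξ : H) :
    ⨅ R : X, ‖T ξ - R.1 ξ‖ ≤ ‖T ξ - S ξ‖ :=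
  ciInf_le (f := fun R : X => ‖T ξ - R.1 ξ‖)
    ⟨0, by rintro _ ⟨R, rfl⟩; exact norm_nonneg _⟩ ⟨S, hS⟩

lemma arveson_nonneg (T : B H) (X : Set (B H)) : 0 ≤ arveson T X :=
  Real.iSup_nonneg fun _ => Real.iInf_nonneg fun _ => norm_nonneg _

lemma iInf_norm_sub_le_arveson (T : B H) {X : Set (B H)} (h0 : 0 ∈ X) (ξ : H) :
    ⨅ S : X, ‖T ξ - S.1 ξ‖ ≤ arveson T X * ‖ξ‖ := by
  rcases eq_or_ne ξ 0 with rfl | hξ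
  · simpa only [map_zero, sub_zero, norm_zero, mul_zero] using iInf_norm_sub_le T h0 (0 : H)
  have hn : 0 < ‖ξ‖ := norm_pos_iff.2 hξ
  set η : H := ((‖ξ‖⁻¹ : ℝ) : ℂ) • ξ with hη
  have hη1 : ‖η‖ = 1 := by
    rw [hη, norm_smul, Complex.norm_real, norm_inv, norm_norm, inv_mul_cancel₀ hn.ne']
  have hle : ⨅ S : X, ‖T η - S.1 η‖ ≤ arveson T X := by
    refine le_ciSup (f := fun ξ : {ξ : H // ‖ξ‖ = 1} => ⨅ S : X, ‖T ξ.1 - S.1 ξ.1‖)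
      ⟨‖T‖, ?_⟩ ⟨η, hη1⟩
    rintro _ ⟨ζ, rfl⟩
    refine (iInf_norm_sub_le T h0 ζ.1).trans ?_
    simpa [ζ.2] using T.le_opNorm ζ.1
  rw [← div_le_iff₀ hn]
  refine le_trans ?_ hle
  have : Nonempty X := ⟨⟨0, h0⟩⟩
  refine le_ciInf fun S => ?_
  have hS : ‖T η - S.1 η‖ = ‖T ξ - S.1 ξ‖ / ‖ξ‖ := by
    rw [hη, map_smul, map_smul, ← smul_sub, norm_smul, Complex.norm_real, norm_inv, norm_norm,
      inv_mul_eq_div]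
  rw [hS]
  gcongr
  exact iInf_norm_sub_le T S.2 ξ

lemma infDist_add_range_le (U : Submodule ℂ (B H)) (Φ : B H →L[ℂ] B H) (T : B H) :
    Metric.infDist T ((U : Set (B H)) + Set.range Φ) ≤ Metric.infDist (T - Φ T) U := by
  refine (Metric.le_infDist ⟨0, U.zero_mem⟩).2 fun S hS => ?_
  refine (Metric.infDist_le_dist_of_mem (Set.add_mem_add hS (Set.mem_range_self T))).trans_eq ?_
  rw [dist_eq_norm, dist_eq_norm, sub_add_eq_sub_sub_swap]

end Arveson

lemma le_sInf_mul {s : Set ℝ} (hs : s.Nonempty) {a d : ℝ} (ha : 0 ≤ a)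
    (h : ∀ k ∈ s, d ≤ k * a) : d ≤ sInf s * a := by
  rcases ha.eq_or_lt with rfl | ha
  · obtain ⟨k, hk⟩ := hs
    simpa using h k hk
  · rw [← div_le_iff₀ ha]
    exact le_csInf hs fun k hk => (div_le_iff₀ ha).2 (h k hk)

section Masa

variable {H : Type*} [NormedAddCommGroup H] [InnerProductSpace ℂ H] [CompleteSpace H]
  {D : StarSubalgebra ℂ (B H)}

/-- The projection onto a closed `D`-invariant subspace belongs to the masa `D`. -/
lemma IsMasa.starProjection_mem (hD : IsMasa D) (K : Submodule ℂ H) [K.HasOrthogonalProjection]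
    (hK : ∀ A ∈ D, ∀ x ∈ K, A x ∈ K) : K.starProjection ∈ D := by
  refine hD.2 _ fun A hA => ContinuousLinearMap.ext fun x => ?_
  refine Submodule.eq_starProjection_of_mem_of_inner_eq_zero
    (hK A hA _ (K.starProjection_apply_mem x)) fun w hw => ?_
  have hw' : (star A) w ∈ K := hK _ (star_mem hA) w hw
  have := K.starProjection_inner_eq_zero x _ hw'
  rwa [ContinuousLinearMap.star_eq_adjoint, ContinuousLinearMap.adjoint_inner_right, map_sub]
    at this

lemma exists_compression (hD : IsMasa D) {U : Submodule ℂ (B H)} (hU : IsBimodule D U) (ξ : H) :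
    ∃ Q ∈ D, ∃ P ∈ D, ‖Q‖ ≤ 1 ∧ ‖P‖ ≤ 1 ∧ (∀ S ∈ U, Q * S * P = 0) ∧ P ξ = ξ ∧
      ∀ T : B H, ⨅ S : (U : Set (B H)), ‖T ξ - S.1 ξ‖ ≤ ‖Q (T ξ)‖ := by
  let ev : B H →ₗ[ℂ] H := (ContinuousLinearMap.apply ℂ H ξ).toLinearMap
  set K : Submodule ℂ H := (U.map ev).topologicalClosure
  set L : Submodule ℂ H := (D.toSubalgebra.toSubmodule.map ev).topologicalClosure
  have hKD : ∀ A ∈ D, ∀ x ∈ K, A x ∈ K := by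
    intro A hA
    refine Set.MapsTo.closure (f := A) ?_ A.continuous
    rintro _ ⟨S, hS, rfl⟩
    exact ⟨A * S, by simpa using hU A hA 1 (one_mem D) S hS, rfl⟩
  have hLD : ∀ A ∈ D, ∀ x ∈ L, A x ∈ L := by
    intro A hA
    refine Set.MapsTo.closure (f := A) ?_ A.continuous
    rintro _ ⟨S, hS, rfl⟩
    exact ⟨A * S, mul_mem (S := StarSubalgebra ℂ (B H)) hA hS, rfl⟩
  have hLK : ∀ S ∈ U, ∀ x ∈ L, S x ∈ K := by
    intro S hS
    refine Set.MapsTo.closure (f := S) ?_ S.continuous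
    rintro _ ⟨A, hA, rfl⟩
    exact ⟨S * A, by simpa using hU 1 (one_mem D) A hA S hS, rfl⟩
  refine ⟨Kᗮ.starProjection, ?_, L.starProjection, hD.starProjection_mem L hLD,
    Submodule.starProjection_norm_le _, Submodule.starProjection_norm_le _, ?_, ?_, ?_⟩
  · rw [Submodule.starProjection_orthogonal']
    exact sub_mem (one_mem D) (hD.starProjection_mem K hKD)
  · intro S hS
    ext x
    change Kᗮ.starProjection (S (L.starProjection x)) = 0
    rw [Submodule.starProjection_orthogonal_val, sub_eq_zero, eq_comm]
    exact Submodule.starProjection_eq_self_iff.2 (hLK S hS _ (L.starProjection_apply_mem x))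
  · refine Submodule.starProjection_eq_self_iff.2 (subset_closure ⟨1, one_mem D, rfl⟩)
  · intro T
    rw [Submodule.starProjection_orthogonal_val]
    refine le_of_forall_pos_le_add fun ε hε => ?_
    obtain ⟨_, ⟨S, hS, rfl⟩, hlt⟩ :=
      Metric.mem_closure_iff.1 (K.starProjection_apply_mem (T ξ)) ε hε
    rw [dist_eq_norm] at hlt
    calc _ ≤ ‖T ξ - S ξ‖ := iInf_norm_sub_le T hS ξ
      _ = ‖(T ξ - K.starProjection (T ξ)) + (K.starProjection (T ξ) - S ξ)‖ := by
        rw [sub_add_sub_cancel]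
      _ ≤ _ := (norm_add_le _ _).trans (by gcongr; exact hlt.le)

lemma arveson_compression_le {Φ : B H →L[ℂ] B H}
    (hΦ : ∀ A ∈ D, ∀ C ∈ D, ∀ T : B H, Φ (A * T * C) = A * Φ T * C)
    {U : Submodule ℂ (B H)} {Q P : B H} (hQ : Q ∈ D) (hP : P ∈ D) (hQ1 : ‖Q‖ ≤ 1)
    (hP1 : ‖P‖ ≤ 1) (hQP : ∀ S ∈ U, Q * S * P = 0) (T : B H) :
    arveson (Q * T * P) (Set.range Φ) ≤ arveson T ((U : Set (B H)) + Set.range Φ) := by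
  have h0 : (0 : B H) ∈ (U : Set (B H)) + Set.range Φ :=
    ⟨0, U.zero_mem, 0, ⟨0, map_zero Φ⟩, add_zero 0⟩
  have hne : Nonempty ((U : Set (B H)) + Set.range Φ : Set (B H)) := ⟨⟨0, h0⟩⟩
  refine Real.iSup_le (fun ξ => ?_) (arveson_nonneg _ _)
  have hPξ : ‖P ξ.1‖ ≤ 1 := by simpa [ξ.2] using P.le_of_opNorm_le hP1 ξ.1
  calc ⨅ S : Set.range Φ, ‖(Q * T * P) ξ.1 - S.1 ξ.1‖
      ≤ ⨅ S : ((U : Set (B H)) + Set.range Φ : Set (B H)), ‖T (P ξ.1) - S.1 (P ξ.1)‖ := by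
        refine le_ciInf ?_
        rintro ⟨_, S, hS, _, ⟨R, rfl⟩, rfl⟩
        have hR : Q * Φ R * P ∈ Set.range Φ := ⟨Q * R * P, hΦ Q hQ P hP R⟩
        refine (iInf_norm_sub_le (Q * T * P) hR ξ.1).trans ?_
        have hS0 : Q (S (P ξ.1)) = 0 := congrArg (fun A : B H => A ξ.1) (hQP S hS)
        have : (Q * T * P) ξ.1 - (Q * Φ R * P) ξ.1
            = Q (T (P ξ.1) - (S + Φ R) (P ξ.1)) := by
          simp [hS0]
        rw [this]
        simpa using Q.le_of_opNorm_le hQ1 (T (P ξ.1) - (S + Φ R) (P ξ.1))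
    _ ≤ arveson T ((U : Set (B H)) + Set.range Φ) * ‖P ξ.1‖ := iInf_norm_sub_le_arveson T h0 _
    _ ≤ _ := mul_le_of_le_one_right (arveson_nonneg _ _) hPξ

lemma arveson_sub_apply_le (hD : IsMasa D) {U : Submodule ℂ (B H)} (hU : IsBimodule D U)
    {Φ : B H →L[ℂ] B H} (hΦ : ∀ A ∈ D, ∀ C ∈ D, ∀ T : B H, Φ (A * T * C) = A * Φ T * C)
    {l : ℝ} (hl : l ∈ lamSet Φ) (T : B H) :
    arveson (T - Φ T) (U : Set (B H)) ≤ l * arveson T ((U : Set (B H)) + Set.range Φ) := by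
  refine Real.iSup_le (fun ξ => ?_) (mul_nonneg hl.1.le (arveson_nonneg _ _))
  obtain ⟨Q, hQ, P, hP, hQ1, hP1, hQP, hPξ, hT⟩ := exists_compression hD hU ξ.1
  calc _ ≤ ‖Q ((T - Φ T) ξ.1)‖ := hT _
    _ = ‖(Q * T * P - Φ (Q * T * P)) ξ.1‖ := by
      rw [hΦ Q hQ P hP]
      simp [hPξ]
    _ ≤ ‖Q * T * P - Φ (Q * T * P)‖ := by
      simpa [ξ.2] using (Q * T * P - Φ (Q * T * P)).le_opNorm ξ.1
    _ ≤ l * arveson (Q * T * P) (Set.range Φ) := hl.2 _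
    _ ≤ _ := mul_le_mul_of_nonneg_left
      (arveson_compression_le hΦ hQ hP hQ1 hP1 hQP T) hl.1.le

end Masa

end SchurHyper

/-- if `U` is a hyperreflexive weak* closed masa-bimodule and
`Φ ∈ 𝔉H`, then the algebraic sum `U + ran Φ` is hyperreflexive and
`d(T, U + ran Φ) ≤ k(U)·λ(Φ)·α(T, U + ran Φ)` for all `T`. -/
theorem stmt9 {H : Type*} [NormedAddCommGroup H] [InnerProductSpace ℂ H] [CompleteSpace H]
    [TopologicalSpace.SeparableSpace H]
    (D : StarSubalgebra ℂ (B H)) (hD : IsMasa D)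
    (U : Submodule ℂ (B H)) (hUbim : IsBimodule D U)
    (hUcl : WStarClosed H (U : Set (B H))) (hUhr : Hyperreflexive (U : Set (B H)))
    (Φ : B H →L[ℂ] B H) (hΦ : MemFH D Φ) :
    Hyperreflexive ((U : Set (B H)) + Set.range ⇑Φ) ∧
    ∀ T : B H, Metric.infDist T ((U : Set (B H)) + Set.range ⇑Φ) ≤
      hyperConst (U : Set (B H)) * lam Φ *
        arveson T ((U : Set (B H)) + Set.range ⇑Φ) := by
  have key : ∀ k ∈ hyperSet (U : Set (B H)), ∀ l ∈ lamSet Φ, ∀ T : B H,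
      Metric.infDist T ((U : Set (B H)) + Set.range ⇑Φ) ≤
        k * (l * arveson T ((U : Set (B H)) + Set.range ⇑Φ)) := fun k hk l hl T =>
    (infDist_add_range_le U Φ T).trans <| (hk.2 _).trans <|
      mul_le_mul_of_nonneg_left (arveson_sub_apply_le hD hUbim hΦ.1.1.2 hl T) hk.1.le
  obtain ⟨k₀, hk₀⟩ := hUhr
  obtain ⟨l₀, hl₀⟩ := hΦ.2
  refine ⟨⟨k₀ * l₀, mul_pos hk₀.1 hl₀.1, fun T => ?_⟩, fun T => ?_⟩
  · rw [mul_assoc]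
    exact key k₀ hk₀ l₀ hl₀ T
  · have ha := arveson_nonneg T ((U : Set (B H)) + Set.range ⇑Φ)
    have hkc : 0 ≤ hyperConst (U : Set (B H)) := Real.sInf_nonneg fun k hk => hk.1.le
    have hl : ∀ l ∈ lamSet Φ, Metric.infDist T ((U : Set (B H)) + Set.range ⇑Φ) ≤
        l * (hyperConst (U : Set (B H)) * arveson T ((U : Set (B H)) + Set.range ⇑Φ)) := by
      intro l hl
      rw [mul_left_comm]
      exact le_sInf_mul ⟨k₀, hk₀⟩ (mul_nonneg hl.1.le ha) fun k hk => key k hk l hl T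
    rw [mul_right_comm, mul_comm]
    exact le_sInf_mul hΦ.2 (mul_nonneg hkc ha) hl
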